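/- Let n ≥ 2 and let f : ℝⁿ → ℝ be continuous, nonnegative and Lebesgue integrable with β := ∫_{ℝⁿ} f dx, such that y ↦ log(|y|/|x−y|) f(y) is Lebesgue integrable for every x ∈ ℝⁿ. Set u₋(x) := −(1/c_n) ∫_{ℝⁿ} log(|y|/|x−y|) f(y) dy. Then ω := e^{n u₋} is a strong A∞ weight with constants depending only on n and β: there exist p > 1, K and C, depending only on n and β, such that ω is an A_p weight with constant K and C^{−1} δ_ω(x,y) ≤ d_ω(x,y) ≤ C δ_ω(x,y) for all x, y ∈ ℝⁿ. -/

import Mathlib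

open MeasureTheory Metric Set
open scoped ENNReal

/-- `c_n := 2^{n-2} Γ(n/2) π^{n/2}`. -/
noncomputable def cN (n : ℕ) : ℝ :=
  (2 : ℝ) ^ ((n : ℝ) - 2) * Real.Gamma ((n : ℝ) / 2) * Real.pi ^ ((n : ℝ) / 2)

/-- Logarithmic potential `u(x) = (1/c_n) ∫ log(|y|/|x-y|) f(y) dy`. -/
noncomputable def logPot (n : ℕ) (f : EuclideanSpace ℝ (Fin n) → ℝ)
    (x : EuclideanSpace ℝ (Fin n)) : ℝ :=
  (1 / cN n) * ∫ y, Real.log (‖y‖ / ‖x - y‖) * f y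

/-- `ω` is an `A_p` weight with constant `K` (for `p > 1`):
for every ball `B`, `(⨍_B ω) · (⨍_B ω^{-1/(p-1)})^{p-1} ≤ K`. -/
def IsApWeight (n : ℕ) (p K : ℝ) (ω : EuclideanSpace ℝ (Fin n) → ℝ) : Prop :=
  ∀ (x : EuclideanSpace ℝ (Fin n)) (r : ℝ), 0 < r →
    ((volume (ball x r)).toReal⁻¹ * ∫ y in ball x r, ω y) *
      ((volume (ball x r)).toReal⁻¹ *
        ∫ y in ball x r, (ω y) ^ (-(1 / (p - 1)) : ℝ)) ^ (p - 1) ≤ K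

/-- `δ_ω(x,y) = (∫_{B_{xy}} ω)^{1/n}`, where `B_{xy}` is the closed ball with
center `(x+y)/2` and radius `|x-y|/2`. -/
noncomputable def deltaW (n : ℕ) (ω : EuclideanSpace ℝ (Fin n) → ℝ)
    (x y : EuclideanSpace ℝ (Fin n)) : ℝ :=
  (∫ z in closedBall (midpoint ℝ x y) (dist x y / 2), ω z) ^ ((1 : ℝ) / n)

/-- `d_ω(x,y)`: infimum of `∫₀^L ω(γ(t))^{1/n} dt` over all `L ≥ 0` and all
1-Lipschitz curves `γ : [0,L] → ℝⁿ` joining `x` to `y` inside `B_{xy}`. -/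
noncomputable def dW (n : ℕ) (ω : EuclideanSpace ℝ (Fin n) → ℝ)
    (x y : EuclideanSpace ℝ (Fin n)) : ℝ :=
  sInf {d : ℝ | ∃ (L : ℝ) (γ : ℝ → EuclideanSpace ℝ (Fin n)),
    0 ≤ L ∧ LipschitzOnWith 1 γ (Set.Icc 0 L) ∧ γ 0 = x ∧ γ L = y ∧
    (∀ t ∈ Set.Icc 0 L, γ t ∈ closedBall (midpoint ℝ x y) (dist x y / 2)) ∧
    d = ∫ t in (0 : ℝ)..L, (ω (γ t)) ^ ((1 : ℝ) / n)}

/-- One-dimensional Hausdorff content: infimum of `Σᵢ diam Bᵢ` over countable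
covers of `E` by balls `Bᵢ`. -/
noncomputable def H1content {n : ℕ} (E : Set (EuclideanSpace ℝ (Fin n))) : ℝ≥0∞ :=
  ⨅ (c : ℕ → EuclideanSpace ℝ (Fin n) × ℝ) (_ : E ⊆ ⋃ i, ball (c i).1 (c i).2),
    ∑' i, ENNReal.ofReal (2 * (c i).2)


namespace SA

/-- Kernel. -/
noncomputable def kap {n : ℕ} (R : ℝ) (x : EuclideanSpace ℝ (Fin n)) : ℝ :=
  Real.exp (Real.posLog (R / ‖x‖)) - 1

lemma measurable_posLog' : Measurable Real.posLog :=
  measurable_const.max Real.measurable_log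

lemma kap_measurable {n : ℕ} (R : ℝ) : Measurable (kap (n := n) R) := by
  unfold kap
  have h : Measurable (fun x : EuclideanSpace ℝ (Fin n) => R / ‖x‖) :=
    measurable_const.div measurable_norm
  exact (Real.measurable_exp.comp (measurable_posLog'.comp h)).sub_const 1

lemma posLog_le_kap {n : ℕ} (R : ℝ) (x : EuclideanSpace ℝ (Fin n)) :
    Real.posLog (R / ‖x‖) ≤ kap R x := by
  unfold kap
  linarith [Real.add_one_le_exp (Real.posLog (R / ‖x‖))]

lemma kap_nonneg {n : ℕ} (R : ℝ) (x : EuclideanSpace ℝ (Fin n)) : 0 ≤ kap R x :=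
  le_trans Real.posLog_nonneg (posLog_le_kap R x)

lemma kap_eq_zero {n : ℕ} {R : ℝ} (hR : 0 < R) {x : EuclideanSpace ℝ (Fin n)} (hx : R ≤ ‖x‖) :
    kap R x = 0 := by
  have hx0 : 0 < ‖x‖ := lt_of_lt_of_le hR hx
  have : Real.posLog (R / ‖x‖) = 0 := by
    rw [Real.posLog_eq_zero_iff, abs_of_nonneg (by positivity)]
    exact (div_le_one hx0).2 hx
  simp [kap, this]

lemma kap_le {n : ℕ} {R : ℝ} (hR : 0 < R) (x : EuclideanSpace ℝ (Fin n)) :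
    kap R x ≤ R / ‖x‖ := by
  have h0 : 0 ≤ R / ‖x‖ := by positivity
  unfold kap
  rw [Real.posLog_eq_log_max_one h0, Real.exp_log (by positivity)]
  have : max 1 (R / ‖x‖) ≤ 1 + R / ‖x‖ := max_le (by linarith) (by linarith)
  linarith

lemma kap_scale {n : ℕ} {R : ℝ} (hR : 0 < R) (x : EuclideanSpace ℝ (Fin n)) :
    kap R x = kap 1 (R⁻¹ • x) := by
  unfold kap
  rw [norm_smul, Real.norm_of_nonneg (by positivity)]
  congr 3
  rw [one_div, mul_inv, inv_inv, div_eq_mul_inv]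

lemma kap_one_integrable {n : ℕ} (hn : 2 ≤ n) :
    Integrable (kap (n := n) 1) := by
  have : Nonempty (Fin n) := ⟨⟨0, by omega⟩⟩
  have h1 : IntegrableOn (fun x : EuclideanSpace ℝ (Fin n) => (1 : ℝ) / ‖x‖) (ball 0 1) := by
    rw [integrableOn_fun_norm_addHaar volume (f := fun r : ℝ => 1 / r)]
    rw [finrank_euclideanSpace_fin]
    have : IntegrableOn (fun y : ℝ => y ^ (n - 2)) (Ioo 0 1) :=
      ((continuous_pow (n - 2)).integrableOn_Icc (a := 0) (b := 1)).mono_set Ioo_subset_Icc_self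
    refine this.congr_fun ?_ measurableSet_Ioo
    intro y hy
    have hy0 : y ≠ 0 := hy.1.ne'
    obtain ⟨m, rfl⟩ : ∃ m, n = m + 2 := ⟨n - 2, by omega⟩
    simp only [smul_eq_mul, Nat.add_sub_cancel]
    have : m + 2 - 1 = m + 1 := by omega
    rw [this, pow_succ]
    field_simp
  rw [← integrable_indicator_iff measurableSet_ball] at h1
  refine h1.mono' (kap_measurable 1).aestronglyMeasurable (Filter.Eventually.of_forall fun x => ?_)
  rw [Real.norm_of_nonneg (kap_nonneg _ _)]
  by_cases hx : x ∈ ball (0 : EuclideanSpace ℝ (Fin n)) 1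
  · rw [indicator_of_mem hx]; exact kap_le one_pos x
  · rw [indicator_of_notMem hx]
    rw [mem_ball_zero_iff, not_lt] at hx
    exact (kap_eq_zero one_pos hx).le

lemma kap_integrable {n : ℕ} (hn : 2 ≤ n) {R : ℝ} (hR : 0 < R) :
    Integrable (kap (n := n) R) := by
  have := (kap_one_integrable hn).comp_smul (R := R⁻¹) (by positivity)
  exact this.congr (Filter.Eventually.of_forall fun x => (kap_scale hR x).symm)

lemma kap_integral {n : ℕ} {R : ℝ} (hR : 0 < R) :
    ∫ x, kap (n := n) R x = R ^ n * ∫ x, kap (n := n) 1 x := by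
  simp_rw [kap_scale hR]
  rw [Measure.integral_comp_inv_smul_of_nonneg _ _ hR.le, finrank_euclideanSpace_fin, smul_eq_mul]

lemma lam_one_integrable : Integrable (fun s : ℝ => Real.posLog (1 / s)) := by
  have h1 : IntegrableOn (fun s : ℝ => Real.log s) (Icc (-1) 1) := by
    rw [integrableOn_Icc_iff_integrableOn_Ioc]
    exact (intervalIntegrable_iff_integrableOn_Ioc_of_le (by norm_num)).1
      (intervalIntegral.intervalIntegrable_log' (a := -1) (b := 1))
  rw [← integrable_indicator_iff measurableSet_Icc] at h1
  have hm : Measurable (fun s : ℝ => Real.posLog (1 / s)) :=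
    measurable_posLog'.comp (measurable_const.div measurable_id)
  refine h1.mono hm.aestronglyMeasurable (Filter.Eventually.of_forall fun x => ?_)
  rw [Real.norm_of_nonneg Real.posLog_nonneg]
  by_cases hx : x ∈ Icc (-1 : ℝ) 1
  · rw [indicator_of_mem hx, Real.posLog_apply, one_div, Real.log_inv, Real.norm_eq_abs]
    exact max_le (abs_nonneg _) (neg_le_abs _)
  · rw [indicator_of_notMem hx, norm_zero]
    refine ((Real.posLog_eq_zero_iff _).2 ?_).le
    have : 1 < |x| := by
      by_contra h
      exact hx (abs_le.1 (not_lt.1 h))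
    rw [abs_div, abs_one]
    exact (div_le_one (by linarith)).2 this.le

lemma lam_scale {R : ℝ} (s : ℝ) :
    Real.posLog (R / s) = (fun s : ℝ => Real.posLog (1 / s)) (R⁻¹ • s) := by
  simp only [smul_eq_mul]
  congr 1
  rw [one_div, mul_inv, inv_inv, div_eq_mul_inv]

lemma lam_integrable {R : ℝ} (hR : 0 < R) : Integrable (fun s : ℝ => Real.posLog (R / s)) := by
  have := lam_one_integrable.comp_smul (R := R⁻¹) (by positivity)
  exact this.congr (Filter.Eventually.of_forall fun x => (lam_scale x).symm)

lemma lam_integral {R : ℝ} (hR : 0 < R) :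
    ∫ s : ℝ, Real.posLog (R / s) = R * ∫ s : ℝ, Real.posLog (1 / s) := by
  have h := Measure.integral_comp_inv_smul_of_nonneg (volume : Measure ℝ)
    (fun s : ℝ => Real.posLog (1 / s)) hR.le
  rw [integral_congr_ae (Filter.Eventually.of_forall fun s => lam_scale (R := R) s), h]
  simp

/-- Fubini. -/
lemma fubini {n : ℕ} {G : Type*} [NormedAddCommGroup G] [InnerProductSpace ℝ G]
    [FiniteDimensional ℝ G] [MeasurableSpace G] [BorelSpace G]
    (κ : G → ℝ) (hκm : Measurable κ) (hκ : Integrable κ)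
    (P : EuclideanSpace ℝ (Fin n) → G) (hP : Measurable P)
    (F : EuclideanSpace ℝ (Fin n) → ℝ) (hFm : Measurable F) (hF : Integrable F) :
    Integrable (Function.uncurry fun (s : G) (y : EuclideanSpace ℝ (Fin n)) => κ (s - P y) * F y)
      (volume.prod volume) ∧
    Integrable (fun s : G => ∫ y, κ (s - P y) * F y) ∧
    (∀ᵐ s : G, Integrable (fun y => κ (s - P y) * F y)) ∧
    ∫ s : G, ∫ y, κ (s - P y) * F y = (∫ s, κ s) * ∫ y, F y := by
  have hm : Measurable (Function.uncurry fun (s : G) (y : EuclideanSpace ℝ (Fin n)) =>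
      κ (s - P y) * F y) := by
    have h1 : Measurable (fun p : G × EuclideanSpace ℝ (Fin n) => p.1 - P p.2) :=
      measurable_fst.sub (hP.comp measurable_snd)
    exact (hκm.comp h1).mul (hFm.comp measurable_snd)
  have hi : Integrable (Function.uncurry fun (s : G) (y : EuclideanSpace ℝ (Fin n)) =>
      κ (s - P y) * F y) (volume.prod volume) := by
    rw [integrable_prod_iff' hm.aestronglyMeasurable]
    constructor
    · exact Filter.Eventually.of_forall fun y =>
        (hκ.comp_sub_right (P y)).mul_const (F y)
    · simp only [Function.uncurry, norm_mul]
      simp_rw [integral_mul_const]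
      have : ∀ y, ∫ s : G, ‖κ (s - P y)‖ = ∫ s : G, ‖κ s‖ := fun y =>
        integral_sub_right_eq_self (fun s => ‖κ s‖) (P y)
      simp_rw [this]
      exact hF.norm.const_mul _
  refine ⟨hi, hi.integral_prod_left, hi.prod_right_ae, ?_⟩
  rw [integral_integral_swap hi]
  simp_rw [integral_mul_const]
  have : ∀ y, ∫ s : G, κ (s - P y) = ∫ s : G, κ s := fun y =>
    integral_sub_right_eq_self κ (P y)
  simp_rw [this]
  rw [integral_const_mul]

lemma kapF_integrable {n : ℕ} (hn : 2 ≤ n) {R : ℝ} (hR : 0 < R)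
    {F : EuclideanSpace ℝ (Fin n) → ℝ} (hF : Continuous F) (z : EuclideanSpace ℝ (Fin n)) :
    Integrable (fun y => kap R (z - y) * F y) := by
  obtain ⟨M, hM⟩ := (isCompact_closedBall z R).exists_bound_of_continuousOn hF.continuousOn
  have h1 : Integrable (fun y => kap R (z - y) * M) :=
    ((kap_integrable hn hR).comp_sub_left z).mul_const M
  have hm : Measurable (fun y => kap R (z - y) * F y) :=
    ((kap_measurable R).comp (measurable_const.sub measurable_id)).mul hF.measurable
  refine h1.mono' hm.aestronglyMeasurable (Filter.Eventually.of_forall fun y => ?_)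
  rw [norm_mul, Real.norm_of_nonneg (kap_nonneg _ _)]
  by_cases hy : R ≤ ‖z - y‖
  · simp [kap_eq_zero hR hy]
  · refine mul_le_mul_of_nonneg_left (hM y ?_) (kap_nonneg _ _)
    rw [mem_closedBall, dist_comm, dist_eq_norm]; exact (not_le.1 hy).le

lemma posLogF_integrable {n : ℕ} (hn : 2 ≤ n) {R : ℝ} (hR : 0 < R)
    {F : EuclideanSpace ℝ (Fin n) → ℝ} (hF : Continuous F) (z : EuclideanSpace ℝ (Fin n)) :
    Integrable (fun y => Real.posLog (R / ‖z - y‖) * F y) := by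
  have hm : Measurable (fun y => Real.posLog (R / ‖z - y‖) * F y) :=
    (measurable_posLog'.comp (measurable_const.div
      (measurable_const.sub measurable_id).norm)).mul hF.measurable
  refine (kapF_integrable hn hR hF z).mono hm.aestronglyMeasurable
    (Filter.Eventually.of_forall fun y => ?_)
  rw [norm_mul, norm_mul, Real.norm_of_nonneg (kap_nonneg _ _),
    Real.norm_of_nonneg Real.posLog_nonneg]
  exact mul_le_mul_of_nonneg_right (posLog_le_kap _ _) (norm_nonneg _)

/-- potential -/
noncomputable def uF {n : ℕ} (F : EuclideanSpace ℝ (Fin n) → ℝ)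
    (z : EuclideanSpace ℝ (Fin n)) : ℝ := -∫ y, Real.log (‖y‖ / ‖z - y‖) * F y

/-- truncated potential -/
noncomputable def hF {n : ℕ} (R : ℝ) (F : EuclideanSpace ℝ (Fin n) → ℝ)
    (z : EuclideanSpace ℝ (Fin n)) : ℝ := ∫ y, Real.posLog (R / ‖z - y‖) * F y

lemma hF_nonneg {n : ℕ} (R : ℝ) {F : EuclideanSpace ℝ (Fin n) → ℝ} (h0 : ∀ y, 0 ≤ F y)
    (z : EuclideanSpace ℝ (Fin n)) : 0 ≤ hF R F z :=
  integral_nonneg fun y => mul_nonneg Real.posLog_nonneg (h0 y)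

lemma uF_measurable {n : ℕ} {F : EuclideanSpace ℝ (Fin n) → ℝ} (hF : Continuous F) :
    Measurable (uF F) := by
  have hm : Measurable (Function.uncurry fun (z y : EuclideanSpace ℝ (Fin n)) =>
      Real.log (‖y‖ / ‖z - y‖) * F y) :=
    (Real.measurable_log.comp (measurable_snd.norm.div
      (measurable_fst.sub measurable_snd).norm)).mul (hF.measurable.comp measurable_snd)
  exact (hm.stronglyMeasurable.integral_prod_right).measurable.neg

lemma hF_measurable {n : ℕ} (R : ℝ) {F : EuclideanSpace ℝ (Fin n) → ℝ} (hF : Continuous F) :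
    Measurable (SA.hF R F) := by
  have hm : Measurable (Function.uncurry fun (z y : EuclideanSpace ℝ (Fin n)) =>
      Real.posLog (R / ‖z - y‖) * F y) :=
    (measurable_posLog'.comp (measurable_const.div
      (measurable_fst.sub measurable_snd).norm)).mul (hF.measurable.comp measurable_snd)
  exact (hm.stronglyMeasurable.integral_prod_right).measurable

lemma log_add_posLog {A R : ℝ} (hA : 0 < A) (hR : 0 < R) :
    Real.log A + Real.posLog (R / A) = Real.log (max A R) := by
  rw [Real.posLog_eq_log_max_one (by positivity), ← Real.log_mul hA.ne' (by positivity),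
    mul_max_of_nonneg _ _ hA.le, mul_one, mul_div_cancel₀ _ hA.ne']

lemma log_le_two {A D R : ℝ} (hA : 0 < A) (hD : 0 < D) (_hR : 0 < R) (h : A ≤ D + R) :
    Real.log (max A R) ≤ Real.log 2 + Real.log (max D R) := by
  rw [← Real.log_mul (by norm_num) (by positivity)]
  apply Real.log_le_log (by positivity)
  have h1 := le_max_left D R
  have h2 := le_max_right D R
  exact max_le (by linarith) (by linarith)

lemma bracket {n : ℕ} (hn : 2 ≤ n) {R : ℝ} (hR : 0 < R)
    {F : EuclideanSpace ℝ (Fin n) → ℝ} (hF : Continuous F) (h0 : ∀ y, 0 ≤ F y)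
    (hFi : Integrable F)
    (hlog : ∀ x : EuclideanSpace ℝ (Fin n),
      Integrable (fun y => Real.log (‖y‖ / ‖x - y‖) * F y)) (x0 : EuclideanSpace ℝ (Fin n)) :
    ∃ a : ℝ, ∀ z ∈ closedBall x0 R, uF F z ≤ a + (∫ y, F y) * Real.log 2 ∧
      a - (∫ y, F y) * Real.log 2 - SA.hF R F z ≤ uF F z := by
  have : Nonempty (Fin n) := ⟨⟨0, by omega⟩⟩
  have hp := fun z => posLogF_integrable hn hR hF z
  have hln : ∀ w, Integrable (fun y => -(Real.log (‖y‖ / ‖w - y‖) * F y)) := fun w => (hlog w).neg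
  have hls : ∀ w, Integrable (fun y => -(Real.log (‖y‖ / ‖w - y‖) * F y)
      + Real.posLog (R / ‖w - y‖) * F y) := fun w => (hln w).add (hp w)
  refine ⟨uF F x0 + SA.hF R F x0, fun z hz => ?_⟩
  have hne : ∀ w : EuclideanSpace ℝ (Fin n), ∀ᵐ y : EuclideanSpace ℝ (Fin n), y ≠ w := fun w => by
    have : (volume : Measure (EuclideanSpace ℝ (Fin n))) {w} = 0 := measure_singleton w
    exact compl_mem_ae_iff.2 this
  have hdist : ‖z - x0‖ ≤ R := by rw [← dist_eq_norm]; exact hz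
  have key : ∀ᵐ y : EuclideanSpace ℝ (Fin n),
      (-Real.log (‖y‖ / ‖z - y‖) ≤
        -Real.log (‖y‖ / ‖x0 - y‖) + Real.posLog (R / ‖x0 - y‖) + Real.log 2) ∧
      (-Real.log (‖y‖ / ‖x0 - y‖) + Real.posLog (R / ‖x0 - y‖) ≤
        -Real.log (‖y‖ / ‖z - y‖) + Real.posLog (R / ‖z - y‖) + Real.log 2) := by
    filter_upwards [hne 0, hne x0, hne z] with y h1 h2 h3
    have hY : 0 < ‖y‖ := norm_pos_iff.2 h1
    have hA : 0 < ‖x0 - y‖ := norm_pos_iff.2 (sub_ne_zero.2 h2.symm)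
    have hD : 0 < ‖z - y‖ := norm_pos_iff.2 (sub_ne_zero.2 h3.symm)
    have e1 : ‖x0 - y‖ ≤ ‖z - y‖ + R := by
      have : x0 - y = (z - y) - (z - x0) := by abel
      rw [this]
      exact (norm_sub_le _ _).trans (by linarith)
    have e2 : ‖z - y‖ ≤ ‖x0 - y‖ + R := by
      have : z - y = (x0 - y) + (z - x0) := by abel
      rw [this]
      exact (norm_add_le _ _).trans (by linarith)
    rw [Real.log_div hY.ne' hA.ne', Real.log_div hY.ne' hD.ne']
    have l1 := log_add_posLog hA hR
    have l2 := log_add_posLog hD hR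
    have m1 := log_le_two hA hD hR e1
    have m2 := log_le_two hD hA hR e2
    have q := Real.posLog_nonneg (x := R / ‖z - y‖)
    constructor <;> linarith
  have hsum : ∀ w, uF F w + SA.hF R F w + (∫ y, F y) * Real.log 2 =
      ∫ y, (-(Real.log (‖y‖ / ‖w - y‖) * F y) + Real.posLog (R / ‖w - y‖) * F y
        + F y * Real.log 2) := fun w => by
    rw [integral_add (hls w) (hFi.mul_const _),
      integral_add (hln w) (hp w), integral_neg, integral_mul_const]
    rfl
  constructor
  · rw [hsum x0]
    unfold uF
    rw [← integral_neg]
    refine integral_mono_ae (hln z)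
      ((hls x0).add (hFi.mul_const _)) ?_
    filter_upwards [key] with y hy
    have := mul_le_mul_of_nonneg_right hy.1 (h0 y)
    linarith
  · have hx0 : uF F x0 + SA.hF R F x0 =
      ∫ y, (-(Real.log (‖y‖ / ‖x0 - y‖) * F y) + Real.posLog (R / ‖x0 - y‖) * F y) := by
      rw [integral_add (hln x0) (hp x0), integral_neg]; rfl
    have : uF F x0 + SA.hF R F x0 ≤ uF F z + SA.hF R F z + (∫ y, F y) * Real.log 2 := by
      rw [hsum z, hx0]
      refine integral_mono_ae (hls x0)
        ((hls z).add (hFi.mul_const _)) ?_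
      filter_upwards [key] with y hy
      have := mul_le_mul_of_nonneg_right hy.2 (h0 y)
      linarith
    linarith

/-- Jensen type bound -/
lemma exp_hF_le {n : ℕ} (hn : 2 ≤ n) {R : ℝ} (hR : 0 < R)
    {F : EuclideanSpace ℝ (Fin n) → ℝ} (hF : Continuous F) (h0 : ∀ y, 0 ≤ F y)
    (hFi : Integrable F) (z : EuclideanSpace ℝ (Fin n)) :
    Real.exp (((∫ y, F y) + 1)⁻¹ * SA.hF R F z) ≤ 1 + ∫ y, kap R (z - y) * F y := by
  set α := ∫ y, F y with hα
  have hα0 : 0 ≤ α := integral_nonneg h0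
  have hp := posLogF_integrable hn hR hF z
  have hk := kapF_integrable hn hR hF z
  set m := (α + 1)⁻¹ * SA.hF R F z with hm
  have hmN : SA.hF R F z = (α + 1) * m := by rw [hm]; field_simp
  have hkI : 0 ≤ ∫ y, kap R (z - y) * F y :=
    integral_nonneg fun y => mul_nonneg (kap_nonneg _ _) (h0 y)
  have t : ∀ v : ℝ, Real.exp m * (1 + v - m) ≤ Real.exp v := fun v => by
    have := Real.add_one_le_exp (v - m)
    calc Real.exp m * (1 + v - m) ≤ Real.exp m * Real.exp (v - m) := by
          gcongr; linarith
      _ = Real.exp v := by rw [← Real.exp_add]; congr 1; ring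
  have t0 := t 0
  rw [Real.exp_zero] at t0
  have t1 : Real.exp m * ((1 - m) * α + (α + 1) * m) ≤ α + ∫ y, kap R (z - y) * F y := by
    have e1 : Real.exp m * ((1 - m) * α + (α + 1) * m) =
        ∫ y, Real.exp m * ((1 - m) * F y + Real.posLog (R / ‖z - y‖) * F y) := by
      rw [integral_const_mul, integral_add (hFi.const_mul _) hp, integral_const_mul, ← hmN]; rfl
    have e2 : α + ∫ y, kap R (z - y) * F y = ∫ y, (F y + kap R (z - y) * F y) := by
      rw [integral_add hFi hk]
    rw [e1, e2]
    refine integral_mono (((hFi.const_mul _).add hp).const_mul _) (hFi.add hk) fun y => ?_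
    have := mul_le_mul_of_nonneg_right (t (Real.posLog (R / ‖z - y‖))) (h0 y)
    have hk' : kap R (z - y) = Real.exp (Real.posLog (R / ‖z - y‖)) - 1 := rfl
    simp only [hk']
    linarith
  have : (α + 1) * Real.exp m ≤ (α + 1) + ∫ y, kap R (z - y) * F y := by nlinarith
  have : (α + 1) * Real.exp m ≤ (α + 1) * (1 + ∫ y, kap R (z - y) * F y) := by nlinarith
  exact le_of_mul_le_mul_left this (by linarith)

/-- volume of the unit ball -/
noncomputable def vB (n : ℕ) : ℝ := (volume : Measure (EuclideanSpace ℝ (Fin n))).real (ball 0 1)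

lemma vB_pos (n : ℕ) : 0 < vB n := by
  unfold vB
  exact ENNReal.toReal_pos (measure_ball_pos _ _ one_pos).ne' measure_ball_lt_top.ne

lemma vol_cball {n : ℕ} (x : EuclideanSpace ℝ (Fin n)) {R : ℝ} (hR : 0 ≤ R) :
    (volume : Measure (EuclideanSpace ℝ (Fin n))).real (closedBall x R) = R ^ n * vB n := by
  unfold vB Measure.real
  rw [Measure.addHaar_closedBall _ _ hR, finrank_euclideanSpace_fin, ENNReal.toReal_mul,
    ENNReal.toReal_ofReal (by positivity)]

/-- constant -/
noncomputable def cM (n : ℕ) (α : ℝ) : ℝ := 1 + (∫ x, kap (n := n) 1 x) * α / vB n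

lemma cM_ge {n : ℕ} {α : ℝ} (hα : 0 ≤ α) : 1 ≤ cM n α := by
  unfold cM
  have : 0 ≤ ∫ x, kap (n := n) 1 x := integral_nonneg fun x => kap_nonneg _ _
  have := vB_pos n
  have : 0 ≤ (∫ x, kap (n := n) 1 x) * α / vB n := by positivity
  linarith

lemma exp_hF_int {n : ℕ} (hn : 2 ≤ n) {R : ℝ} (hR : 0 < R)
    {F : EuclideanSpace ℝ (Fin n) → ℝ} (hF : Continuous F) (h0 : ∀ y, 0 ≤ F y)
    (hFi : Integrable F) (x0 : EuclideanSpace ℝ (Fin n)) :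
    IntegrableOn (fun z => Real.exp (((∫ y, F y) + 1)⁻¹ * SA.hF R F z)) (closedBall x0 R) ∧
    ∫ z in closedBall x0 R, Real.exp (((∫ y, F y) + 1)⁻¹ * SA.hF R F z) ≤
      R ^ n * vB n * cM n (∫ y, F y) := by
  obtain ⟨-, f2, -, f4⟩ := fubini (kap (n := n) R) (kap_measurable R) (kap_integrable hn hR) id
    measurable_id F hF.measurable hFi
  simp only [id] at f2 f4
  have hc : IntegrableOn (fun _ : EuclideanSpace ℝ (Fin n) => (1 : ℝ)) (closedBall x0 R) :=
    integrableOn_const measure_closedBall_lt_top.ne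
  have hb : IntegrableOn (fun z => 1 + ∫ y, kap R (z - y) * F y) (closedBall x0 R) :=
    hc.add f2.integrableOn
  have hm : Measurable (fun z => Real.exp (((∫ y, F y) + 1)⁻¹ * SA.hF R F z)) :=
    Real.measurable_exp.comp ((hF_measurable R hF).const_mul _)
  have hi : IntegrableOn (fun z => Real.exp (((∫ y, F y) + 1)⁻¹ * SA.hF R F z))
      (closedBall x0 R) := by
    refine hb.mono' hm.aestronglyMeasurable (Filter.Eventually.of_forall fun z => ?_)
    rw [Real.norm_of_nonneg (Real.exp_pos _).le]
    exact exp_hF_le hn hR hF h0 hFi z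
  refine ⟨hi, ?_⟩
  have s1 := setIntegral_mono hi hb (fun z => exp_hF_le hn hR hF h0 hFi z)
  refine s1.trans ?_
  rw [integral_add hc f2.integrableOn, setIntegral_const, vol_cball x0 hR.le]
  have s2 : ∫ z in closedBall x0 R, ∫ y, kap R (z - y) * F y ≤
      ∫ z, ∫ y, kap R (z - y) * F y :=
    setIntegral_le_integral f2 (Filter.Eventually.of_forall fun z =>
      integral_nonneg fun y => mul_nonneg (kap_nonneg _ _) (h0 y))
  rw [f4, kap_integral hR] at s2
  have hv := (vB_pos n).ne'
  unfold cM
  have : R ^ n * vB n * (1 + (∫ x, kap (n := n) 1 x) * (∫ y, F y) / vB n) =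
    R ^ n * vB n + R ^ n * (∫ x, kap (n := n) 1 x) * (∫ y, F y) := by field_simp
  rw [this, smul_eq_mul, mul_one]
  linarith

lemma hyper_null {n : ℕ} {e : EuclideanSpace ℝ (Fin n)} (he : e ≠ 0) (s : ℝ) :
    (volume : Measure (EuclideanSpace ℝ (Fin n))) {y | inner ℝ e y = s} = 0 := by
  rcases eq_empty_or_nonempty {y : EuclideanSpace ℝ (Fin n) | inner ℝ e y = s} with h | ⟨y0, hy0⟩
  · rw [h]; simp
  · have hk : LinearMap.ker (innerSL ℝ e).toLinearMap ≠ ⊤ := by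
      intro h
      have : e ∈ LinearMap.ker (innerSL ℝ e).toLinearMap := by rw [h]; trivial
      rw [LinearMap.mem_ker] at this
      simp at this
      exact he this
    have h1 := Measure.addHaar_submodule
      (volume : Measure (EuclideanSpace ℝ (Fin n))) _ hk
    have h2 : {y : EuclideanSpace ℝ (Fin n) | inner ℝ e y = s} =
        (fun y => y + -y0) ⁻¹' (LinearMap.ker (innerSL ℝ e).toLinearMap : Set _) := by
      ext y
      simp only [mem_ofPred_eq] at hy0
      simp [inner_add_right, hy0, add_neg_eq_zero]
    rw [h2, measure_preimage_add_right]
    exact h1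

lemma push_le {L : ℝ} (hL : 0 ≤ L) {φ : ℝ → ℝ} (hc : Continuous φ)
    (hφ : LipschitzOnWith 1 φ (Icc 0 L)) :
    (volume : Measure ℝ).restrict (Icc (φ 0) (φ L)) ≤
      ((volume : Measure ℝ).restrict (Icc 0 L)).map φ := by
  refine Measure.le_iff.2 fun A hA => ?_
  rw [Measure.map_apply hc.measurable hA, Measure.restrict_apply hA,
    Measure.restrict_apply (hc.measurable hA)]
  have hsub : A ∩ Icc (φ 0) (φ L) ⊆ φ '' (φ ⁻¹' A ∩ Icc 0 L) := by
    rintro s ⟨hs, hs2⟩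
    obtain ⟨t, ht, rfl⟩ := intermediate_value_Icc hL hc.continuousOn hs2
    exact ⟨t, ⟨hs, ht⟩, rfl⟩
  refine (measure_mono hsub).trans ?_
  have := (hφ.mono (inter_subset_right (s := φ ⁻¹' A))).hausdorffMeasure_image_le
    (d := 1) zero_le_one
  rw [hausdorffMeasure_real] at this
  simpa using this

/-- constant -/
noncomputable def c1 : ℝ := ∫ s : ℝ, Real.posLog (1 / s)

lemma curve {n : ℕ} (hn : 2 ≤ n) {R : ℝ} (hR : 0 < R)
    {F : EuclideanSpace ℝ (Fin n) → ℝ} (hF : Continuous F) (h0 : ∀ y, 0 ≤ F y)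
    (hFi : Integrable F) (x y : EuclideanSpace ℝ (Fin n)) (hxy : dist x y = 2 * R)
    {L : ℝ} (hL : 0 ≤ L) (γ : ℝ → EuclideanSpace ℝ (Fin n))
    (hγ : LipschitzOnWith 1 γ (Icc 0 L)) (hγ0 : γ 0 = x) (hγL : γ L = y) :
    2 * R * Real.exp (-((∫ y, F y) * c1 / 2)) ≤
      ∫ t in (0 : ℝ)..L, Real.exp (-(SA.hF R F (γ t))) := by
  set α := ∫ y, F y with hα
  set c := α * c1 / 2 with hc
  set e : EuclideanSpace ℝ (Fin n) := (2 * R)⁻¹ • (y - x) with he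
  have hyx : ‖y - x‖ = 2 * R := by rw [← hxy, dist_comm, dist_eq_norm]
  have hen : ‖e‖ = 1 := by
    rw [he, norm_smul, hyx, Real.norm_of_nonneg (by positivity)]; field_simp
  have he0 : e ≠ 0 := by rw [← norm_pos_iff, hen]; exact one_pos
  set P : EuclideanSpace ℝ (Fin n) → ℝ := fun z => inner ℝ e z with hP
  have hPc : Continuous P := by fun_prop
  have hPl : ∀ z w, |P z - P w| ≤ ‖z - w‖ := fun z w => by
    have := abs_real_inner_le_norm e (z - w)
    rw [inner_sub_right, hen, one_mul] at this
    exact this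
  have hPxy : P y - P x = 2 * R := by
    have : P y - P x = inner ℝ e (y - x) := by rw [inner_sub_right]
    rw [this, he, real_inner_smul_left, real_inner_self_eq_norm_sq, hyx]
    field_simp
  -- extension of the curve
  set γ' : ℝ → EuclideanSpace ℝ (Fin n) := fun t => γ (projIcc 0 L hL t) with hγ'
  have hγ'c : Continuous γ' := by
    have h1 : Continuous ((Icc 0 L).domRestrict γ) := hγ.continuousOn.domRestrict
    exact h1.comp continuous_projIcc
  have hγ'e : ∀ t ∈ Icc 0 L, γ' t = γ t := fun t ht => by
    simp only [hγ', projIcc_of_mem hL ht]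
  set φ : ℝ → ℝ := fun t => P (γ' t) with hφ
  have hφc : Continuous φ := hPc.comp hγ'c
  have hφl : LipschitzOnWith 1 φ (Icc 0 L) := by
    refine LipschitzOnWith.of_dist_le_mul fun s hs t ht => ?_
    have := hγ.dist_le_mul s hs t ht
    rw [Real.dist_eq]
    refine (hPl _ _).trans ?_
    rw [hγ'e s hs, hγ'e t ht, ← dist_eq_norm]
    exact this
  have hφ0 : φ 0 = P x := by simp only [hφ, hγ'e 0 ⟨le_rfl, hL⟩, hγ0]
  have hφL : φ L = P y := by simp only [hφ, hγ'e L ⟨hL, le_rfl⟩, hγL]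
  have hpush := push_le hL hφc hφl
  rw [hφ0, hφL] at hpush
  -- one dimensional potential
  have hlm : Measurable (fun s : ℝ => Real.posLog (R / s)) :=
    measurable_posLog'.comp (measurable_const.div measurable_id)
  obtain ⟨-, f2, f3, f4⟩ := fubini (fun s : ℝ => Real.posLog (R / s)) hlm (lam_integrable hR) P
    hPc.measurable F hF.measurable hFi
  have hjm : Measurable (Function.uncurry fun (s : ℝ) (y : EuclideanSpace ℝ (Fin n)) =>
      Real.posLog (R / (s - P y)) * F y) :=
    (hlm.comp (measurable_fst.sub (hPc.measurable.comp measurable_snd))).mul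
      (hF.measurable.comp measurable_snd)
  set G : ℝ → ℝ := fun s => ∫ y, Real.posLog (R / (s - P y)) * F y with hG
  have hGm : Measurable G := (hjm.stronglyMeasurable.integral_prod_right).measurable
  have hG0 : ∀ s, 0 ≤ G s := fun s => integral_nonneg fun y => mul_nonneg Real.posLog_nonneg (h0 y)
  set good : Set ℝ := {s | Integrable (fun y => Real.posLog (R / (s - P y)) * F y)} with hgood
  have hgm : MeasurableSet good := measurableSet_integrable hjm.stronglyMeasurable
  have hGE : ∀ w, P w ∈ good → SA.hF R F w ≤ G (P w) := fun w hw => by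
    refine integral_mono_ae (posLogF_integrable hn hR hF w) hw ?_
    have hnull : ∀ᵐ z : EuclideanSpace ℝ (Fin n), ¬ (inner ℝ e z = P w) :=
      compl_mem_ae_iff.2 (hyper_null he0 (P w))
    filter_upwards [hnull] with z hz
    refine mul_le_mul_of_nonneg_right ?_ (h0 z)
    rw [← Real.posLog_abs (R / (P w - P z)), abs_div, abs_of_pos hR]
    have hpos : 0 < |P w - P z| := abs_pos.2 (sub_ne_zero.2 fun h => hz h.symm)
    exact Real.posLog_le_posLog (by positivity) (div_le_div_of_nonneg_left hR.le hpos (hPl w z))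
  set W : ℝ → ℝ≥0∞ := good.indicator fun s => ENNReal.ofReal (Real.exp (-(G s))) with hW
  have hexpGm : Measurable (fun s => Real.exp (-(G s))) := Real.measurable_exp.comp hGm.neg
  have hWm : Measurable W := (hexpGm.ennreal_ofReal).indicator hgm
  have hhm : Measurable (fun t => Real.exp (-(SA.hF R F (γ' t)))) :=
    Real.measurable_exp.comp (((hF_measurable R hF).comp hγ'c.measurable).neg)
  have hle1 : ∀ v : ℝ, 0 ≤ v → ‖Real.exp (-v)‖ ≤ 1 := fun v hv => by
    rw [Real.norm_of_nonneg (Real.exp_pos _).le, Real.exp_le_one_iff]; linarith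
  have hi1 : IntegrableOn (fun t => Real.exp (-(SA.hF R F (γ' t)))) (Icc 0 L) :=
    Measure.integrableOn_of_bounded (M := 1) (measure_Icc_lt_top.ne) hhm.aestronglyMeasurable
      (Filter.Eventually.of_forall fun t => hle1 _ (hF_nonneg R h0 _))
  have hi2 : IntegrableOn (fun s => Real.exp (-(G s))) (Icc (P x) (P y)) :=
    Measure.integrableOn_of_bounded (M := 1) (measure_Icc_lt_top.ne) hexpGm.aestronglyMeasurable
      (Filter.Eventually.of_forall fun t => hle1 _ (hG0 _))
  have chain : ∫⁻ s in Icc (P x) (P y), ENNReal.ofReal (Real.exp (-(G s))) ≤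
      ∫⁻ t in Icc 0 L, ENNReal.ofReal (Real.exp (-(SA.hF R F (γ' t)))) := by
    calc ∫⁻ s in Icc (P x) (P y), ENNReal.ofReal (Real.exp (-(G s)))
        = ∫⁻ s in Icc (P x) (P y), W s := by
          refine lintegral_congr_ae ?_
          filter_upwards [ae_restrict_of_ae f3] with s hs
          have hs' : s ∈ good := hs
          simp only [hW]
          rw [indicator_of_mem hs']
      _ ≤ ∫⁻ s, W s ∂(((volume : Measure ℝ).restrict (Icc 0 L)).map φ) :=
          lintegral_mono' hpush le_rfl
      _ = ∫⁻ t in Icc 0 L, W (φ t) := lintegral_map hWm hφc.measurable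
      _ ≤ _ := by
          refine lintegral_mono fun t => ?_
          by_cases hg : φ t ∈ good
          · simp only [hW]
            rw [indicator_of_mem hg]
            refine ENNReal.ofReal_le_ofReal (Real.exp_le_exp.2 (neg_le_neg ?_))
            exact hGE _ hg
          · simp only [hW]
            rw [indicator_of_notMem hg]
            exact zero_le
  rw [← ofReal_integral_eq_lintegral_ofReal hi2
      (Filter.Eventually.of_forall fun s => (Real.exp_pos _).le),
    ← ofReal_integral_eq_lintegral_ofReal hi1
      (Filter.Eventually.of_forall fun s => (Real.exp_pos _).le),
    ENNReal.ofReal_le_ofReal_iff (integral_nonneg fun s => (Real.exp_pos _).le)] at chain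
  have hfin : ∫ t in (0 : ℝ)..L, Real.exp (-(SA.hF R F (γ t))) =
      ∫ t in Icc 0 L, Real.exp (-(SA.hF R F (γ' t))) := by
    rw [intervalIntegral.integral_of_le hL, ← integral_Icc_eq_integral_Ioc]
    refine setIntegral_congr_fun measurableSet_Icc fun t ht => ?_
    simp only [hγ'e t ht]
  rw [hfin]
  refine le_trans ?_ chain
  -- lower bound
  have hvol : (volume : Measure ℝ).real (Icc (P x) (P y)) = 2 * R := by
    rw [Measure.real, Real.volume_Icc, ENNReal.toReal_ofReal (by linarith), hPxy]
  have hGi : ∫ s in Icc (P x) (P y), G s ≤ 2 * R * c := by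
    have := setIntegral_le_integral (s := Icc (P x) (P y)) f2
      (Filter.Eventually.of_forall fun s => hG0 s)
    rw [f4, lam_integral hR] at this
    refine this.trans (le_of_eq ?_)
    simp only [hc, c1, ← hα]
    ring
  have hcI : IntegrableOn (fun _ : ℝ => 1 + c) (Icc (P x) (P y)) :=
    integrableOn_const measure_Icc_lt_top.ne
  have hGI : IntegrableOn G (Icc (P x) (P y)) := f2.integrableOn
  calc 2 * R * Real.exp (-c) ≤ Real.exp (-c) * (2 * R * (1 + c) - ∫ s in Icc (P x) (P y), G s) := by
        have := Real.exp_pos (-c)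
        nlinarith
    _ = ∫ s in Icc (P x) (P y), Real.exp (-c) * ((1 + c) - G s) := by
        rw [integral_const_mul, integral_sub hcI hGI, setIntegral_const, hvol, smul_eq_mul]
    _ ≤ ∫ s in Icc (P x) (P y), Real.exp (-(G s)) := by
        refine setIntegral_mono ((hcI.sub hGI).const_mul _) hi2 fun s => ?_
        have := Real.add_one_le_exp (c - G s)
        calc Real.exp (-c) * ((1 + c) - G s) ≤ Real.exp (-c) * Real.exp (c - G s) := by
              gcongr; linarith
          _ = Real.exp (-(G s)) := by rw [← Real.exp_add]; congr 1; ring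

lemma ball_est {n : ℕ} (hn : 2 ≤ n) {R : ℝ} (hR : 0 < R)
    {F : EuclideanSpace ℝ (Fin n) → ℝ} (hF : Continuous F) (h0 : ∀ y, 0 ≤ F y)
    (hFi : Integrable F) (x0 : EuclideanSpace ℝ (Fin n)) {α a k : ℝ} (hα : ∫ y, F y = α)
    (hup : ∀ z ∈ closedBall x0 R, uF F z ≤ a + k)
    (hlo : ∀ z ∈ closedBall x0 R, a - k - SA.hF R F z ≤ uF F z) :
    (∫ z in closedBall x0 R, Real.exp (n * uF F z) ≤ R ^ n * vB n * Real.exp (n * (a + k))) ∧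
    (R ^ n * vB n * Real.exp (n * (a - k - (α + 1) * cM n α)) ≤
      ∫ z in closedBall x0 R, Real.exp (n * uF F z)) ∧
    (∫ z in closedBall x0 R, Real.exp (-(α + 1)⁻¹ * uF F z) ≤
      R ^ n * vB n * cM n α * Real.exp (-(α + 1)⁻¹ * (a - k))) := by
  have hα0 : 0 ≤ α := hα ▸ integral_nonneg h0
  have hN : 0 < α + 1 := by linarith
  have hs : 0 < (α + 1)⁻¹ := by positivity
  have hn0 : (0 : ℝ) ≤ n := Nat.cast_nonneg n
  have hfin : (volume : Measure (EuclideanSpace ℝ (Fin n))) (closedBall x0 R) < ∞ :=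
    measure_closedBall_lt_top
  obtain ⟨q1, q2⟩ := exp_hF_int hn hR hF h0 hFi x0
  rw [hα] at q1 q2
  have hB : MeasurableSet (closedBall x0 R) := measurableSet_closedBall
  have hwb : ∀ z ∈ closedBall x0 R, ‖Real.exp (n * uF F z)‖ ≤ Real.exp (n * (a + k)) :=
    fun z hz => by
      rw [Real.norm_of_nonneg (Real.exp_pos _).le]
      exact Real.exp_le_exp.2 (mul_le_mul_of_nonneg_left (hup z hz) hn0)
  have hwm : Measurable (fun z => Real.exp (n * uF F z)) :=
    Real.measurable_exp.comp ((uF_measurable hF).const_mul _)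
  have hwi : IntegrableOn (fun z => Real.exp (n * uF F z)) (closedBall x0 R) :=
    Measure.integrableOn_of_bounded (M := Real.exp (n * (a + k))) hfin.ne hwm.aestronglyMeasurable
      ((ae_restrict_iff' hB).2 (Filter.Eventually.of_forall hwb))
  refine ⟨?_, ?_, ?_⟩
  · have := norm_setIntegral_le_of_norm_le_const hfin hwb
    rw [vol_cball x0 hR.le] at this
    linarith [(Real.le_norm_self _).trans this]
  · have hle : ∀ z, SA.hF R F z ≤ (α + 1) * Real.exp ((α + 1)⁻¹ * SA.hF R F z) := fun z => by
      have := Real.add_one_le_exp ((α + 1)⁻¹ * SA.hF R F z)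
      have h2 : SA.hF R F z = (α + 1) * ((α + 1)⁻¹ * SA.hF R F z) := by field_simp
      conv_lhs => rw [h2]
      exact mul_le_mul_of_nonneg_left (by linarith) hN.le
    have hhi : IntegrableOn (SA.hF R F) (closedBall x0 R) := by
      refine (q1.const_mul (α + 1)).mono' (hF_measurable R hF).aestronglyMeasurable
        (Filter.Eventually.of_forall fun z => ?_)
      rw [Real.norm_of_nonneg (hF_nonneg R h0 z)]
      exact hle z
    have hh : ∫ z in closedBall x0 R, SA.hF R F z ≤ R ^ n * vB n * ((α + 1) * cM n α) := by
      refine (setIntegral_mono hhi (q1.const_mul (α + 1)) hle).trans ?_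
      rw [integral_const_mul]
      have := mul_le_mul_of_nonneg_left q2 hN.le
      linarith
    set c := (α + 1) * cM n α with hc
    have hcI : IntegrableOn (fun _ : EuclideanSpace ℝ (Fin n) => 1 + n * c) (closedBall x0 R) :=
      integrableOn_const hfin.ne
    have hnI : IntegrableOn (fun z => n * SA.hF R F z) (closedBall x0 R) := hhi.const_mul _
    have e0 := Real.exp_pos (n * (a - k - c))
    calc R ^ n * vB n * Real.exp (n * (a - k - c))
        ≤ Real.exp (n * (a - k - c)) *
          (R ^ n * vB n * (1 + n * c) - n * ∫ z in closedBall x0 R, SA.hF R F z) := by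
          have h3 := mul_le_mul_of_nonneg_left hh hn0
          have h4 : R ^ n * vB n ≤
              R ^ n * vB n * (1 + n * c) - n * ∫ z in closedBall x0 R, SA.hF R F z := by linarith
          rw [mul_comm]
          exact mul_le_mul_of_nonneg_left h4 e0.le
      _ = ∫ z in closedBall x0 R, Real.exp (n * (a - k - c)) * ((1 + n * c) - n * SA.hF R F z) := by
          rw [integral_const_mul, integral_sub hcI hnI, setIntegral_const, vol_cball x0 hR.le,
            smul_eq_mul, integral_const_mul]
      _ ≤ ∫ z in closedBall x0 R, Real.exp (n * uF F z) := by
          refine setIntegral_mono_on ((hcI.sub hnI).const_mul _) hwi hB fun z hz => ?_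
          have := Real.add_one_le_exp (n * c - n * SA.hF R F z)
          calc _ ≤ Real.exp (n * (a - k - c)) * Real.exp (n * c - n * SA.hF R F z) := by
                refine mul_le_mul_of_nonneg_left ?_ e0.le
                linarith
            _ = Real.exp (n * (a - k - SA.hF R F z)) := by
                rw [← Real.exp_add]; congr 1; ring
            _ ≤ _ := Real.exp_le_exp.2 (mul_le_mul_of_nonneg_left (hlo z hz) hn0)
  · have hpt : ∀ z ∈ closedBall x0 R, Real.exp (-(α + 1)⁻¹ * uF F z) ≤
        Real.exp (-(α + 1)⁻¹ * (a - k)) * Real.exp ((α + 1)⁻¹ * SA.hF R F z) := fun z hz => by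
      rw [← Real.exp_add]
      apply Real.exp_le_exp.2
      have := mul_le_mul_of_nonneg_left (hlo z hz) hs.le
      linarith
    have hm : Measurable (fun z => Real.exp (-(α + 1)⁻¹ * uF F z)) :=
      Real.measurable_exp.comp ((uF_measurable hF).const_mul _)
    have hi : IntegrableOn (fun z => Real.exp (-(α + 1)⁻¹ * uF F z)) (closedBall x0 R) := by
      refine (q1.const_mul (Real.exp (-(α + 1)⁻¹ * (a - k)))).mono' hm.aestronglyMeasurable
        ((ae_restrict_iff' hB).2 (Filter.Eventually.of_forall fun z hz => ?_))
      rw [Real.norm_of_nonneg (Real.exp_pos _).le]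
      exact hpt z hz
    refine (setIntegral_mono_on hi (q1.const_mul _) hB hpt).trans ?_
    rw [integral_const_mul]
    have := mul_le_mul_of_nonneg_left q2 (Real.exp_pos (-(α + 1)⁻¹ * (a - k))).le
    linarith

lemma ap_est {n : ℕ} (hn : 2 ≤ n)
    {F : EuclideanSpace ℝ (Fin n) → ℝ} (hF : Continuous F) (h0 : ∀ y, 0 ≤ F y)
    (hFi : Integrable F)
    (hlog : ∀ x : EuclideanSpace ℝ (Fin n),
      Integrable (fun y => Real.log (‖y‖ / ‖x - y‖) * F y)) {α : ℝ} (hα : ∫ y, F y = α) :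
    IsApWeight n (1 + n * (α + 1))
      (Real.exp (2 * n * (α * Real.log 2)) * cM n α ^ (n * (α + 1)))
      (fun z => Real.exp (n * uF F z)) := by
  intro x0 R hR
  have : Nonempty (Fin n) := ⟨⟨0, by omega⟩⟩
  have hα0 : 0 ≤ α := hα ▸ integral_nonneg h0
  have hN : 0 < α + 1 := by linarith
  have hn0 : (0 : ℝ) < n := by exact_mod_cast (by omega : 0 < n)
  obtain ⟨a, ha⟩ := bracket hn hR hF h0 hFi hlog x0
  rw [hα] at ha
  set k := α * Real.log 2 with hk
  obtain ⟨b1, -, b3⟩ := ball_est hn hR hF h0 hFi x0 hα (fun z hz => (ha z hz).1)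
    (fun z hz => (ha z hz).2)
  have hae : (ball x0 R : Set (EuclideanSpace ℝ (Fin n))) =ᵐ[volume] closedBall x0 R :=
    ae_eq_of_subset_of_measure_ge ball_subset_closedBall
      (Measure.addHaar_closedBall_eq_addHaar_ball volume x0 R).le
      measurableSet_ball.nullMeasurableSet measure_closedBall_lt_top.ne
  have hv : (volume (ball x0 R)).toReal = R ^ n * vB n := by
    rw [← Measure.addHaar_closedBall_eq_addHaar_ball]; exact vol_cball x0 hR.le
  have hvp : 0 < R ^ n * vB n := by have := vB_pos n; positivity
  have hcM : 0 < cM n α := lt_of_lt_of_le one_pos (cM_ge hα0)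
  rw [hv, setIntegral_congr_set hae, setIntegral_congr_set hae]
  have hp : (1 : ℝ) + n * (α + 1) - 1 = n * (α + 1) := by ring
  rw [hp]
  have hpow : ∀ z, Real.exp (n * uF F z) ^ (-(1 / (n * (α + 1))) : ℝ) =
      Real.exp (-(α + 1)⁻¹ * uF F z) := fun z => by
    rw [← Real.exp_mul]; congr 1; field_simp
  simp_rw [hpow]
  have g1 : (R ^ n * vB n)⁻¹ * ∫ z in closedBall x0 R, Real.exp (n * uF F z) ≤
      Real.exp (n * (a + k)) := by
    rw [inv_mul_le_iff₀ hvp]; exact b1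
  have g2 : (R ^ n * vB n)⁻¹ * ∫ z in closedBall x0 R, Real.exp (-(α + 1)⁻¹ * uF F z) ≤
      cM n α * Real.exp (-(α + 1)⁻¹ * (a - k)) := by
    rw [inv_mul_le_iff₀ hvp]; linarith
  have g0 : 0 ≤ (R ^ n * vB n)⁻¹ * ∫ z in closedBall x0 R, Real.exp (-(α + 1)⁻¹ * uF F z) :=
    mul_nonneg (by positivity) (integral_nonneg fun z => (Real.exp_pos _).le)
  have g3 := Real.rpow_le_rpow g0 g2 (by positivity : (0 : ℝ) ≤ n * (α + 1))
  refine (mul_le_mul g1 g3 (Real.rpow_nonneg g0 _) (Real.exp_pos _).le).trans (le_of_eq ?_)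
  rw [Real.mul_rpow hcM.le (Real.exp_pos _).le, ← Real.exp_mul]
  have : -(α + 1)⁻¹ * (a - k) * (n * (α + 1)) = -(n * (a - k)) := by field_simp
  rw [this, mul_left_comm, ← Real.exp_add, mul_comm]
  congr 2
  ring

lemma rpow_root {n : ℕ} (hn : 2 ≤ n) {R v w : ℝ} (hR : 0 ≤ R) (hv : 0 ≤ v) :
    (R ^ n * v * Real.exp (n * w)) ^ ((1 : ℝ) / n) = R * v ^ ((1 : ℝ) / n) * Real.exp w := by
  have hn0 : (n : ℝ) ≠ 0 := by exact_mod_cast (by omega : n ≠ 0)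
  rw [Real.mul_rpow (by positivity) (Real.exp_pos _).le, Real.mul_rpow (by positivity) hv,
    ← Real.exp_mul, one_div, Real.pow_rpow_inv_natCast hR (by omega)]
  congr 2
  field_simp

lemma exp_root {n : ℕ} (hn : 2 ≤ n) (w : ℝ) :
    Real.exp (n * w) ^ ((1 : ℝ) / n) = Real.exp w := by
  have hn0 : (n : ℝ) ≠ 0 := by exact_mod_cast (by omega : n ≠ 0)
  rw [← Real.exp_mul]; congr 1; field_simp

lemma dist_est {n : ℕ} (hn : 2 ≤ n)
    {F : EuclideanSpace ℝ (Fin n) → ℝ} (hF : Continuous F) (h0 : ∀ y, 0 ≤ F y)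
    (hFi : Integrable F)
    (hlog : ∀ x : EuclideanSpace ℝ (Fin n),
      Integrable (fun y => Real.log (‖y‖ / ‖x - y‖) * F y)) {α : ℝ} (hα : ∫ y, F y = α)
    (x y : EuclideanSpace ℝ (Fin n)) (hne : x ≠ y) :
    ∃ T : ℝ, 0 < T ∧
    deltaW n (fun z => Real.exp (n * uF F z)) x y ≤
      T * (vB n ^ ((1 : ℝ) / n) * Real.exp (α * Real.log 2)) ∧
    T * (vB n ^ ((1 : ℝ) / n) * Real.exp (-(α * Real.log 2) - (α + 1) * cM n α)) ≤
      deltaW n (fun z => Real.exp (n * uF F z)) x y ∧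
    dW n (fun z => Real.exp (n * uF F z)) x y ≤ T * (2 * Real.exp (α * Real.log 2)) ∧
    T * (2 * Real.exp (-(α * Real.log 2) - α * c1 / 2)) ≤
      dW n (fun z => Real.exp (n * uF F z)) x y := by
  have hd : 0 < dist x y := dist_pos.2 hne
  set R := dist x y / 2 with hRdef
  have hR : 0 < R := by positivity
  have hxy : dist x y = 2 * R := by rw [hRdef]; ring
  have hv := vB_pos n
  obtain ⟨a, ha⟩ := bracket hn hR hF h0 hFi hlog (midpoint ℝ x y)
  rw [hα] at ha
  set k := α * Real.log 2 with hk
  obtain ⟨b1, b2, -⟩ := ball_est hn hR hF h0 hFi _ hα (fun z hz => (ha z hz).1)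
    (fun z hz => (ha z hz).2)
  have hmem : (∫ t in (0 : ℝ)..(2 * R), (Real.exp (n * uF F
      (AffineMap.lineMap x y (t / (2 * R))))) ^ ((1 : ℝ) / n)) ∈
      {d : ℝ | ∃ (L : ℝ) (γ : ℝ → EuclideanSpace ℝ (Fin n)),
    0 ≤ L ∧ LipschitzOnWith 1 γ (Set.Icc 0 L) ∧ γ 0 = x ∧ γ L = y ∧
    (∀ t ∈ Set.Icc 0 L, γ t ∈ closedBall (midpoint ℝ x y) (dist x y / 2)) ∧
    d = ∫ t in (0 : ℝ)..L, ((fun z => Real.exp (n * uF F z)) (γ t)) ^ ((1 : ℝ) / n)} := by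
    refine ⟨2 * R, fun t => AffineMap.lineMap x y (t / (2 * R)), by positivity, ?_, ?_, ?_, ?_, rfl⟩
    · refine LipschitzOnWith.of_dist_le_mul fun s _ t _ => ?_
      rw [dist_lineMap_lineMap, hxy, Real.dist_eq, Real.dist_eq, ← sub_div, abs_div,
        abs_of_pos (by positivity : 0 < 2 * R)]
      simp only [NNReal.coe_one, one_mul]
      rw [div_mul_cancel₀ _ (by positivity)]
    · simp
    · have : 2 * R / (2 * R) = 1 := by field_simp
      simp only [this, AffineMap.lineMap_apply_one]
    · intro t ht
      rw [mem_closedBall, midpoint, dist_lineMap_lineMap, hxy, Real.dist_eq, invOf_eq_inv]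
      have h1 : t / (2 * R) ≤ 1 := (div_le_one (by positivity)).2 ht.2
      have h2 : 0 ≤ t / (2 * R) := div_nonneg ht.1 (by positivity)
      have h3 : |t / (2 * R) - 2⁻¹| ≤ 1 / 2 := by
        rw [abs_le]; constructor <;> linarith
      have := mul_le_mul_of_nonneg_right h3 (by positivity : 0 ≤ 2 * R)
      linarith
  refine ⟨R * Real.exp a, by positivity, ?_, ?_, ?_, ?_⟩
  · unfold deltaW
    refine (Real.rpow_le_rpow (integral_nonneg fun z => (Real.exp_pos _).le) b1
      (by positivity)).trans (le_of_eq ?_)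
    rw [rpow_root hn hR.le hv.le, Real.exp_add]; ring
  · unfold deltaW
    refine le_trans (le_of_eq ?_) (Real.rpow_le_rpow (by positivity) b2 (by positivity))
    rw [rpow_root hn hR.le hv.le]
    have : a - k - (α + 1) * cM n α = a + (-k - (α + 1) * cM n α) := by ring
    rw [this, Real.exp_add]; ring
  · refine (csInf_le ?_ hmem).trans ?_
    · refine ⟨0, ?_⟩
      rintro d ⟨L, γ, hL, -, -, -, -, rfl⟩
      exact intervalIntegral.integral_nonneg hL fun t _ => Real.rpow_nonneg (Real.exp_pos _).le _
    · obtain ⟨L, γ, hL, -, -, -, -, -⟩ := hmem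
      refine (Real.le_norm_self _).trans ?_
      have := intervalIntegral.norm_integral_le_of_norm_le_const (a := 0) (b := 2 * R)
        (C := Real.exp (a + k)) (f := fun t => (Real.exp (n * uF F
          (AffineMap.lineMap x y (t / (2 * R))))) ^ ((1 : ℝ) / n)) ?_
      · refine this.trans (le_of_eq ?_)
        rw [sub_zero, abs_of_pos (by positivity), Real.exp_add]; ring
      · intro t ht
        rw [uIoc_of_le (by positivity)] at ht
        rw [exp_root hn, Real.norm_of_nonneg (Real.exp_pos _).le]
        refine Real.exp_le_exp.2 (ha _ ?_).1
        rw [mem_closedBall, midpoint, dist_lineMap_lineMap, hxy, Real.dist_eq, invOf_eq_inv]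
        have h1 : t / (2 * R) ≤ 1 := (div_le_one (by positivity)).2 ht.2
        have h2 : 0 ≤ t / (2 * R) := div_nonneg ht.1.le (by positivity)
        have h3 : |t / (2 * R) - 2⁻¹| ≤ 1 / 2 := by
          rw [abs_le]; constructor <;> linarith
        have := mul_le_mul_of_nonneg_right h3 (by positivity : 0 ≤ 2 * R)
        linarith
  · refine le_csInf ⟨_, hmem⟩ ?_
    rintro d ⟨L, γ, hL, hγ, hγ0, hγL, hγB, rfl⟩
    have hcv := curve hn hR hF h0 hFi x y hxy hL γ hγ hγ0 hγL
    rw [hα] at hcv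
    simp only [exp_root hn]
    have hγm : AEMeasurable γ (volume.restrict (Icc 0 L)) :=
      hγ.continuousOn.aemeasurable measurableSet_Icc
    have bdd : ∀ {g : EuclideanSpace ℝ (Fin n) → ℝ} (M : ℝ), Measurable g →
        (∀ z ∈ closedBall (midpoint ℝ x y) R, ‖g z‖ ≤ M) →
        IntervalIntegrable (fun t => g (γ t)) volume 0 L := fun {g} M hg hM => by
      rw [intervalIntegrable_iff_integrableOn_Icc_of_le hL]
      exact Integrable.of_bound (hg.comp_aemeasurable hγm).aestronglyMeasurable M
        ((ae_restrict_iff' measurableSet_Icc).2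
          (Filter.Eventually.of_forall fun t ht => hM _ (hγB t ht)))
    have i1 : IntervalIntegrable (fun t => Real.exp (uF F (γ t))) volume 0 L := by
      refine bdd (g := fun z => Real.exp (uF F z)) (Real.exp (a + k))
        (Real.measurable_exp.comp (uF_measurable hF)) fun z hz => ?_
      rw [Real.norm_of_nonneg (Real.exp_pos _).le]
      exact Real.exp_le_exp.2 (ha z hz).1
    have i2 : IntervalIntegrable (fun t => Real.exp (-(SA.hF R F (γ t)))) volume 0 L := by
      refine bdd (g := fun z => Real.exp (-(SA.hF R F z))) 1
        (Real.measurable_exp.comp (hF_measurable R hF).neg) fun z _ => ?_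
      rw [Real.norm_of_nonneg (Real.exp_pos _).le, Real.exp_le_one_iff]
      linarith [hF_nonneg R h0 z]
    calc R * Real.exp a * (2 * Real.exp (-k - α * c1 / 2))
        = Real.exp (a - k) * (2 * R * Real.exp (-(α * c1 / 2))) := by
          rw [sub_eq_add_neg a k, sub_eq_add_neg (-k), Real.exp_add, Real.exp_add]; ring
      _ ≤ Real.exp (a - k) * ∫ t in (0 : ℝ)..L, Real.exp (-(SA.hF R F (γ t))) :=
          mul_le_mul_of_nonneg_left hcv (Real.exp_pos _).le
      _ = ∫ t in (0 : ℝ)..L, Real.exp (a - k) * Real.exp (-(SA.hF R F (γ t))) := by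
          rw [intervalIntegral.integral_const_mul]
      _ ≤ ∫ t in (0 : ℝ)..L, Real.exp (uF F (γ t)) := by
          refine intervalIntegral.integral_mono_on hL (i2.const_mul _) i1 fun t ht => ?_
          rw [← Real.exp_add]
          refine Real.exp_le_exp.2 ?_
          have := (ha _ (hγB t ht)).2
          linarith

lemma cN_pos {n : ℕ} (hn : 2 ≤ n) : 0 < cN n := by
  have hn0 : (0 : ℝ) < n := by exact_mod_cast (by omega : 0 < n)
  unfold cN
  have := Real.Gamma_pos_of_pos (by positivity : (0 : ℝ) < n / 2)
  have := Real.pi_pos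
  positivity

end SA

/-- For `f ≥ 0` integrable with `β = ∫ f`, the weight
`ω = e^{n u₋}` with `u₋(x) = -(1/c_n) ∫ log(|y|/|x-y|) f(y) dy` is a strong `A_∞`
weight, with constants depending only on `n` and `β`. -/
theorem strongAinfty_of_negativePart
    (n : ℕ) (hn : 2 ≤ n) (β : ℝ) :
    ∃ p K C : ℝ, 1 < p ∧ 0 < C ∧
      ∀ f : EuclideanSpace ℝ (Fin n) → ℝ,
        Continuous f →
        (∀ y, 0 ≤ f y) →
        Integrable f →
        (∀ x : EuclideanSpace ℝ (Fin n),
          Integrable (fun y => Real.log (‖y‖ / ‖x - y‖) * f y)) →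
        (∫ y, f y) = β →
        IsApWeight n p K (fun x => Real.exp ((n : ℝ) * (-(logPot n f x)))) ∧
        ∀ x y : EuclideanSpace ℝ (Fin n),
          C⁻¹ * deltaW n (fun z => Real.exp ((n : ℝ) * (-(logPot n f z)))) x y ≤
              dW n (fun z => Real.exp ((n : ℝ) * (-(logPot n f z)))) x y ∧
          dW n (fun z => Real.exp ((n : ℝ) * (-(logPot n f z)))) x y ≤
              C * deltaW n (fun z => Real.exp ((n : ℝ) * (-(logPot n f z)))) x y := by
  have hc := SA.cN_pos hn
  set α := β / cN n with hα
  set A2 := SA.vB n ^ ((1 : ℝ) / n) * Real.exp (α * Real.log 2) with hA2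
  set A1 := SA.vB n ^ ((1 : ℝ) / n) *
    Real.exp (-(α * Real.log 2) - (α + 1) * SA.cM n α) with hA1
  set D2 := 2 * Real.exp (α * Real.log 2) with hD2
  set D1 := 2 * Real.exp (-(α * Real.log 2) - α * SA.c1 / 2) with hD1
  have hv := SA.vB_pos n
  have pA2 : 0 < A2 := by positivity
  have pA1 : 0 < A1 := by positivity
  have pD2 : 0 < D2 := by positivity
  have pD1 : 0 < D1 := by positivity
  have hn0 : (0 : ℝ) < n := by exact_mod_cast (by omega : 0 < n)
  by_cases hβ : 0 ≤ β
  swap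
  · refine ⟨2, 0, 1, by norm_num, by norm_num, ?_⟩
    intro f _ h0 _ _ hfβ
    exact absurd (hfβ ▸ integral_nonneg h0) hβ
  have hα0 : 0 ≤ α := by positivity
  refine ⟨1 + n * (α + 1), Real.exp (2 * n * (α * Real.log 2)) * SA.cM n α ^ (n * (α + 1)),
    A2 / D1 + D2 / A1, ?_, by positivity, ?_⟩
  · have : 0 < (n : ℝ) * (α + 1) := by positivity
    linarith
  intro f hf h0 hfi hlog hfβ
  set F : EuclideanSpace ℝ (Fin n) → ℝ := fun y => (1 / cN n) * f y with hFdef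
  have hF : Continuous F := continuous_const.mul hf
  have hF0 : ∀ y, 0 ≤ F y := fun y => mul_nonneg (by positivity) (h0 y)
  have hFi : Integrable F := hfi.const_mul _
  have hFl : ∀ x : EuclideanSpace ℝ (Fin n),
      Integrable (fun y => Real.log (‖y‖ / ‖x - y‖) * F y) := fun x => by
    refine ((hlog x).const_mul (1 / cN n)).congr (Filter.Eventually.of_forall fun y => ?_)
    simp only [hFdef]; ring
  have hFα : ∫ y, F y = α := by
    simp only [hFdef]
    rw [integral_const_mul, hfβ, hα]; ring
  have hu : ∀ z, -(logPot n f z) = SA.uF F z := fun z => by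
    unfold logPot SA.uF
    rw [← integral_const_mul]
    congr 1
    refine integral_congr_ae (Filter.Eventually.of_forall fun y => ?_)
    simp only [hFdef]; ring
  simp_rw [hu]
  refine ⟨SA.ap_est hn hF hF0 hFi hFl hFα, fun x y => ?_⟩
  have pC : 0 < A2 / D1 + D2 / A1 := by positivity
  have q1 : 0 ≤ A2 / D1 := by positivity
  have q2 : 0 ≤ D2 / A1 := by positivity
  by_cases hxy : x = y
  · subst hxy
    have hδ : deltaW n (fun z => Real.exp (n * SA.uF F z)) x x = 0 := by
      have : Nonempty (Fin n) := ⟨⟨0, by omega⟩⟩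
      unfold deltaW
      have h0' : (volume : Measure (EuclideanSpace ℝ (Fin n))) (closedBall (midpoint ℝ x x) (dist x x / 2)) = 0 := by
        simp
      rw [Measure.restrict_eq_zero.2 h0', integral_zero_measure, Real.zero_rpow (by positivity)]
    have hnn : ∀ d ∈ {d : ℝ | ∃ (L : ℝ) (γ : ℝ → EuclideanSpace ℝ (Fin n)),
        0 ≤ L ∧ LipschitzOnWith 1 γ (Set.Icc 0 L) ∧ γ 0 = x ∧ γ L = x ∧
        (∀ t ∈ Set.Icc 0 L, γ t ∈ closedBall (midpoint ℝ x x) (dist x x / 2)) ∧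
        d = ∫ t in (0 : ℝ)..L, ((fun z => Real.exp (n * SA.uF F z)) (γ t)) ^ ((1 : ℝ) / n)},
        0 ≤ d := by
      rintro d ⟨L, γ, hL, -, -, -, -, rfl⟩
      exact intervalIntegral.integral_nonneg hL fun t _ => Real.rpow_nonneg (Real.exp_pos _).le _
    rw [hδ, mul_zero, mul_zero]
    refine ⟨Real.sInf_nonneg hnn, csInf_le ⟨0, hnn⟩ ?_⟩
    refine ⟨0, fun _ => x, le_rfl, ?_, rfl, rfl, ?_, ?_⟩
    · exact LipschitzOnWith.of_dist_le_mul fun s _ t _ => by simp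
    · intro t _; simp
    · simp
  · obtain ⟨T, hT, e1, e2, e3, e4⟩ := SA.dist_est hn hF hF0 hFi hFl hFα x y hxy
    constructor
    · rw [inv_mul_le_iff₀ pC]
      have hd0 : 0 ≤ T * D1 := by positivity
      calc _ ≤ T * A2 := e1
        _ = A2 / D1 * (T * D1) := by field_simp
        _ ≤ (A2 / D1 + D2 / A1) * (T * D1) := mul_le_mul_of_nonneg_right (by linarith) hd0
        _ ≤ _ := mul_le_mul_of_nonneg_left e4 pC.le
    · have hd0 : 0 ≤ T * A1 := by positivity
      calc _ ≤ T * D2 := e3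
        _ = D2 / A1 * (T * A1) := by field_simp
        _ ≤ (A2 / D1 + D2 / A1) * (T * A1) := mul_le_mul_of_nonneg_right (by linarith) hd0
        _ ≤ _ := mul_le_mul_of_nonneg_left e2 pC.le
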